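/- arXiv:2305.16667 — 3 statements merged into one kernel-verified Lean document; each statement's English description precedes it below -/
import Mathlib

section
/- Let (T, μ, η) be a monad on a category 𝕏 with finite biproducts that admits a fusion invertor h°. Then (T, μ, η) is a Hopf monad: for all objects A, B, the map k_{A,B} : T(A) ⊕ T(B) → T(A ⊕ T(B)) defined by k_{A,B} = T(1_A ⊕ T(0)) ∘ h°_A ∘ π₁ + T(ι₂) ∘ η_{T(B)} ∘ π₂ is a two-sided inverse of the fusion operator h_{A,B}. -/
/-!
Hopf monads on a category with finite biproducts (Bruguières–Lack–Virelizier style),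
following "Hopf Monads on Biproducts".

Setting: `C` is a category with a zero object and binary biproducts (hence zero
morphisms), so that each hom-set carries the commutative monoid structure induced by
the biproducts.  `badd f g` is the induced addition of parallel maps.
-/

namespace HopfBiproducts

open CategoryTheory CategoryTheory.Limits ZeroObject

universe v u

variable {C : Type u} [Category.{v} C] [HasZeroObject C] [HasZeroMorphisms C]
  [HasBinaryBiproducts C]

/-- The addition of parallel maps induced by binary biproducts:
`f + g = ⟨f, g⟩ ≫ [1, 1]`. -/
noncomputable def badd {X Y : C} (f g : X ⟶ Y) : X ⟶ Y :=
  biprod.lift f g ≫ biprod.desc (𝟙 Y) (𝟙 Y)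

/-- The fusion operator `h_{A,B} = ι₁ ∘ T(π₁) + ι₂ ∘ μ_B ∘ T(π₂)` of a monad on a
category with finite biproducts. -/
noncomputable def fusion (T : Monad C) (A B : C) :
    T.obj (A ⊞ T.obj B) ⟶ T.obj A ⊞ T.obj B :=
  badd (T.map biprod.fst ≫ biprod.inl) (T.map biprod.snd ≫ T.μ.app B ≫ biprod.inr)


/-- A *fusion invertor* for a monad `(T, μ, η)` on a category with finite biproducts:
a natural transformation `h°_A : T(A) ⟶ T(A ⊕ T(𝟘))` satisfying
[FI.1] `T(π₁) ∘ h°_A = 1`, [FI.2] `μ_𝟘 ∘ T(π₂) ∘ h°_A = 0`, and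
[FI.3] `T(1_A ⊕ T(0)) ∘ h°_A ∘ T(π₁) + T(ι₂) ∘ η_{T(B)} ∘ μ_B ∘ T(π₂) = 1` for all `B`. -/
structure FusionInvertor (T : Monad C) where
  /-- the component `h°_A : T(A) ⟶ T(A ⊕ T(𝟘))` -/
  app : ∀ A : C, T.obj A ⟶ T.obj (A ⊞ T.obj (0 : C))
  naturality : ∀ {A A' : C} (f : A ⟶ A'),
    T.map f ≫ app A' = app A ≫ T.map (biprod.map f (𝟙 (T.obj (0 : C))))
  fi1 : ∀ A : C, app A ≫ T.map biprod.fst = 𝟙 (T.obj A)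
  fi2 : ∀ A : C, app A ≫ T.map biprod.snd ≫ T.μ.app (0 : C) = 0
  fi3 : ∀ A B : C,
    badd (T.map biprod.fst ≫ app A ≫ T.map (biprod.map (𝟙 A) (T.map (0 : (0 : C) ⟶ B))))
        (T.map biprod.snd ≫ T.μ.app B ≫ T.η.app (T.obj B) ≫ T.map biprod.inr) =
      𝟙 (T.obj (A ⊞ T.obj B))

lemma comp_badd {X Y Z : C} (h : X ⟶ Y) (f g : Y ⟶ Z) :
    h ≫ badd f g = badd (h ≫ f) (h ≫ g) := by
  have : h ≫ biprod.lift f g = biprod.lift (h ≫ f) (h ≫ g) := by ext <;> simp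
  simp only [badd, ← this, Category.assoc]

lemma badd_comp {X Y Z : C} (f g : X ⟶ Y) (h : Y ⟶ Z) :
    badd f g ≫ h = badd (f ≫ h) (g ≫ h) := by
  have hlift : biprod.lift (f ≫ h) (g ≫ h) = biprod.lift f g ≫ biprod.map h h := by
    ext <;> simp
  have hdesc : biprod.map h h ≫ biprod.desc (𝟙 Z) (𝟙 Z) =
      biprod.desc (𝟙 Y) (𝟙 Y) ≫ h := by
    ext <;> simp
  simp only [badd, hlift, Category.assoc, hdesc]

lemma badd_zero {X Y : C} (f : X ⟶ Y) : badd f 0 = f := by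
  have : biprod.lift f (0 : X ⟶ Y) = f ≫ biprod.inl := by ext <;> simp
  simp [badd, this]

lemma zero_badd {X Y : C} (f : X ⟶ Y) : badd 0 f = f := by
  have : biprod.lift (0 : X ⟶ Y) f = f ≫ biprod.inr := by ext <;> simp
  simp [badd, this]

lemma fusion_fst (T : Monad C) (A B : C) :
    fusion T A B ≫ biprod.fst = T.map biprod.fst := by
  simp [fusion, badd_comp, badd_zero]

lemma fusion_snd (T : Monad C) (A B : C) :
    fusion T A B ≫ biprod.snd = T.map biprod.snd ≫ T.μ.app B := by
  simp [fusion, badd_comp, zero_badd]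

/-- if `(T, μ, η)` has a fusion invertor `h°`, then it is a Hopf monad:
`k_{A,B} = T(1_A ⊕ T(0)) ∘ h°_A ∘ π₁ + T(ι₂) ∘ η_{T(B)} ∘ π₂` is a two-sided inverse
of the fusion operator `h_{A,B}`. -/
theorem isHopf_of_fusionInvertor (T : Monad C) (hc : FusionInvertor T) (A B : C) :
    fusion T A B ≫
        badd (biprod.fst ≫ hc.app A ≫ T.map (biprod.map (𝟙 A) (T.map (0 : (0 : C) ⟶ B))))
          (biprod.snd ≫ T.η.app (T.obj B) ≫ T.map biprod.inr) =
      𝟙 (T.obj (A ⊞ T.obj B)) ∧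
    badd (biprod.fst ≫ hc.app A ≫ T.map (biprod.map (𝟙 A) (T.map (0 : (0 : C) ⟶ B))))
          (biprod.snd ≫ T.η.app (T.obj B) ≫ T.map biprod.inr) ≫ fusion T A B =
      𝟙 (T.obj A ⊞ T.obj B) := by
  have hfst : hc.app A ≫ T.map (biprod.map (𝟙 A) (T.map (0 : (0 : C) ⟶ B))) ≫
      T.map biprod.fst = 𝟙 _ := by
    rw [← T.map_comp, biprod.map_fst, Category.comp_id, hc.fi1]
  have hsnd : hc.app A ≫ T.map (biprod.map (𝟙 A) (T.map (0 : (0 : C) ⟶ B))) ≫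
      T.map biprod.snd ≫ T.μ.app B = 0 := by
    have hμ : T.map (T.map (0 : (0 : C) ⟶ B)) ≫ T.μ.app B =
        T.μ.app 0 ≫ T.map (0 : (0 : C) ⟶ B) := T.μ.naturality _
    rw [← T.map_comp_assoc, biprod.map_snd, T.map_comp, Category.assoc, hμ]
    simpa using congrArg (· ≫ T.map (0 : (0 : C) ⟶ B)) (hc.fi2 A)
  have hη : T.η.app (T.obj B) ≫ T.map (0 : T.obj B ⟶ A) = 0 := by
    have := T.η.naturality (0 : T.obj B ⟶ A)
    simpa using this.symm
  constructor
  · rw [comp_badd, ← Category.assoc, fusion_fst, ← Category.assoc (fusion T A B), fusion_snd]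
    simpa using hc.fi3 A B
  · have hinr_fst : T.η.app (T.obj B) ≫ T.map (biprod.inr : T.obj B ⟶ A ⊞ T.obj B) ≫
        T.map biprod.fst = 0 := by
      rw [← T.map_comp, biprod.inr_fst, hη]
    have hinr_snd : T.η.app (T.obj B) ≫ T.map (biprod.inr : T.obj B ⟶ A ⊞ T.obj B) ≫
        T.map biprod.snd ≫ T.μ.app B = 𝟙 _ := by
      rw [← T.map_comp_assoc, biprod.inr_snd, T.map_id, Category.id_comp, T.left_unit]
    apply biprod.hom_ext' <;> apply biprod.hom_ext <;>
      simp only [Category.assoc, fusion_fst, fusion_snd, badd_comp, comp_badd, hfst, hsnd,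
        hinr_fst, hinr_snd] <;>
      simp [badd_zero, zero_badd]

end HopfBiproducts
end

section
/- Let (T, μ, η) be a Hopf monad on a preadditive category 𝕏 with finite biproducts. Then the inverse of the fusion operator h⁻¹_{A,B} : T(A) ⊕ T(B) → T(A ⊕ T(B)) is given by h⁻¹_{A,B} = T(ι₁) ∘ π₁ − T(ι₂) ∘ η_{T(B)} ∘ T(0) ∘ π₁ + T(ι₂) ∘ η_{T(B)} ∘ π₂, where 0 : A → B is the zero map. -/
/-!
Hopf monads on a preadditive category (category with negatives) with finite
biproducts, following "Hopf Monads on Biproducts".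
-/

namespace HopfBiproductsNeg

open CategoryTheory CategoryTheory.Limits ZeroObject

universe v u

variable {C : Type u} [Category.{v} C] [Preadditive C] [HasZeroObject C]
  [HasBinaryBiproducts C]

/-- The fusion operator `h_{A,B} = ι₁ ∘ T(π₁) + ι₂ ∘ μ_B ∘ T(π₂)` of a monad on a
preadditive category with finite biproducts. -/
noncomputable def fusion (T : Monad C) (A B : C) :
    T.obj (A ⊞ T.obj B) ⟶ T.obj A ⊞ T.obj B :=
  T.map biprod.fst ≫ biprod.inl + T.map biprod.snd ≫ T.μ.app B ≫ biprod.inr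

/-- Multiplying after the image of a zero map gives the image of a zero map, since a zero map
into `T B` factors through the unit. -/
theorem map_zero_comp_mu (T : Monad C) (A B : C) :
    T.map (0 : A ⟶ T.obj B) ≫ T.μ.app B = T.map (0 : A ⟶ B) := by
  have h : (0 : A ⟶ T.obj B) = (0 : A ⟶ B) ≫ T.η.app B := by simp
  rw [h, T.map_comp, Category.assoc, T.right_unit]
  exact Category.comp_id _

/-- The image of a zero map vanishes after precomposition with the unit. -/
theorem eta_comp_map_zero (T : Monad C) (A B : C) :
    T.η.app A ≫ T.map (0 : A ⟶ B) = 0 := by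
  have h := T.η.naturality (0 : A ⟶ B)
  simpa using h.symm

theorem fusion_fst (T : Monad C) (A B : C) :
    fusion T A B ≫ biprod.fst = T.map biprod.fst := by
  simp [fusion]

theorem fusion_snd (T : Monad C) (A B : C) :
    fusion T A B ≫ biprod.snd = T.map biprod.snd ≫ T.μ.app B := by
  simp [fusion]

/-- for a Hopf monad on a preadditive category with finite biproducts,
the inverse of the fusion operator is
`h⁻¹_{A,B} = T(ι₁) ∘ π₁ − T(ι₂) ∘ η_{T(B)} ∘ T(0) ∘ π₁ + T(ι₂) ∘ η_{T(B)} ∘ π₂`. -/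
theorem inv_fusion_eq_of_neg (T : Monad C) [∀ A B : C, IsIso (fusion T A B)] (A B : C) :
    inv (fusion T A B) =
      biprod.fst ≫ T.map (biprod.inl : A ⟶ A ⊞ T.obj B) -
        biprod.fst ≫ T.map (0 : A ⟶ B) ≫ T.η.app (T.obj B) ≫ T.map biprod.inr +
        biprod.snd ≫ T.η.app (T.obj B) ≫ T.map biprod.inr := by
  apply IsIso.inv_eq_of_inv_hom_id
  apply biprod.hom_ext
  · simp only [Category.assoc, fusion_fst, Preadditive.add_comp, Preadditive.sub_comp,
      ← T.map_comp, biprod.inl_fst, biprod.inr_fst, eta_comp_map_zero]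
    simp
  · have left_unit : T.η.app (T.obj B) ≫ T.μ.app B = 𝟙 (T.obj B) := T.left_unit B
    simp only [Category.assoc, fusion_snd, Preadditive.add_comp, Preadditive.sub_comp,
      ← T.map_comp_assoc, biprod.inl_snd, biprod.inr_snd, map_zero_comp_mu]
    simp [left_unit]

end HopfBiproductsNeg
end

section
/- Let (T, μ, η) be a monad on a preadditive category 𝕏 with finite biproducts. Then (T, μ, η) is a Hopf monad if and only if for all pairs of objects A, B of 𝕏 the equality T(1_A ⊕ 0) + T(ι₂) ∘ η_{T(B)} ∘ μ_B ∘ T(π₂) − T(ι₂) ∘ η_{T(B)} ∘ T(0) = 1_{T(A ⊕ T(B))} holds, where the first 0 is the zero endomorphism of T(B) and the second 0 : A ⊕ T(B) → B is the zero map. -/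
/-!
Hopf monads on a preadditive category (category with negatives) with finite
biproducts, following "Hopf Monads on Biproducts".
-/

namespace HopfBiproductsNeg

open CategoryTheory CategoryTheory.Limits ZeroObject

universe v u

variable {C : Type u} [Category.{v} C] [Preadditive C] [HasZeroObject C]
  [HasBinaryBiproducts C]

set_option linter.unusedSectionVars false

theorem eta_map_zero {D : Type u} [Category.{v} D] [Preadditive D] (T : Monad D)
    (X Y : D) : T.η.app X ≫ T.map (0 : X ⟶ Y) = 0 := by
  simpa using (T.η.naturality (0 : X ⟶ Y)).symm

theorem map_zero_mu {D : Type u} [Category.{v} D] [Preadditive D] (T : Monad D)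
    (A B : D) :
    T.map (0 : A ⟶ T.obj B) ≫ T.μ.app B = T.map (0 : A ⟶ B) := by
  have h : (0 : A ⟶ T.obj B) = (0 : A ⟶ B) ≫ T.η.app B := by simp
  rw [h, T.map_comp, Category.assoc, T.right_unit]
  exact Category.comp_id _

/-- The section of the fusion operator whose restriction along `ι₁` is
`T(ι₁) − T(ι₂) ∘ η_{T(B)} ∘ T(0)` and whose restriction along `ι₂` is `T(ι₂) ∘ η_{T(B)}`. -/
noncomputable def fusionSection (T : Monad C) (A B : C) :
    T.obj A ⊞ T.obj B ⟶ T.obj (A ⊞ T.obj B) :=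
  biprod.desc
    (T.map biprod.inl - T.map (0 : A ⟶ B) ≫ T.η.app (T.obj B) ≫ T.map biprod.inr)
    (T.η.app (T.obj B) ≫ T.map biprod.inr)

theorem fusionSection_map_fst (T : Monad C) (A B : C) :
    fusionSection T A B ≫ T.map biprod.fst = biprod.fst := by
  apply biprod.hom_ext' <;>
    simp [fusionSection, Preadditive.sub_comp, ← T.map_comp, eta_map_zero]

theorem fusionSection_map_snd_mu (T : Monad C) (A B : C) :
    fusionSection T A B ≫ T.map biprod.snd ≫ T.μ.app B = biprod.snd := by
  have h₁ : T.map (biprod.inl : A ⟶ A ⊞ T.obj B) ≫ T.map biprod.snd ≫ T.μ.app B =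
      T.map (0 : A ⟶ B) := by
    rw [← T.map_comp_assoc, biprod.inl_snd, map_zero_mu]
  have h₂ : T.η.app (T.obj B) ≫ T.map (biprod.inr : T.obj B ⟶ A ⊞ T.obj B) ≫
      T.map biprod.snd ≫ T.μ.app B = 𝟙 (T.obj B) := by
    rw [← T.map_comp_assoc, biprod.inr_snd, T.map_id, Category.id_comp, T.left_unit]
    rfl
  apply biprod.hom_ext'
  · simp only [fusionSection, biprod.inl_desc_assoc, Preadditive.sub_comp, Category.assoc, h₁, h₂,
      biprod.inl_snd]
    exact sub_eq_zero.mpr (Category.comp_id _).symm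
  · simpa [fusionSection] using h₂

theorem fusionSection_fusion (T : Monad C) (A B : C) :
    fusionSection T A B ≫ fusion T A B = 𝟙 (T.obj A ⊞ T.obj B) := by
  have h := fusionSection_map_snd_mu T A B
  apply biprod.hom_ext
  · simp [fusion, Preadditive.add_comp, fusionSection_map_fst]
  · simp [fusion, Preadditive.add_comp, h]

theorem fusion_fusionSection (T : Monad C) (A B : C) :
    fusion T A B ≫ fusionSection T A B =
      T.map (biprod.map (𝟙 A) (0 : T.obj B ⟶ T.obj B)) +
          T.map biprod.snd ≫ T.μ.app B ≫ T.η.app (T.obj B) ≫ T.map biprod.inr -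
        T.map (0 : A ⊞ T.obj B ⟶ B) ≫ T.η.app (T.obj B) ≫ T.map biprod.inr := by
  have h₁ : biprod.map (𝟙 A) (0 : T.obj B ⟶ T.obj B) = biprod.fst ≫ biprod.inl := by
    apply biprod.hom_ext <;> simp
  have h₂ : (0 : A ⊞ T.obj B ⟶ B) = biprod.fst ≫ (0 : A ⟶ B) := by simp
  rw [h₁, h₂, T.map_comp, T.map_comp]
  simp only [fusion, fusionSection, Preadditive.add_comp, Preadditive.comp_sub, Category.assoc,
    biprod.inl_desc, biprod.inr_desc]
  abel

theorem isIso_fusion_iff (T : Monad C) (A B : C) :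
    IsIso (fusion T A B) ↔
      fusion T A B ≫ fusionSection T A B = 𝟙 (T.obj (A ⊞ T.obj B)) := by
  refine ⟨fun _ ↦ ?_, fun h ↦ ⟨fusionSection T A B, h, fusionSection_fusion T A B⟩⟩
  rw [IsIso.eq_inv_of_inv_hom_id (fusionSection_fusion T A B), IsIso.hom_inv_id]

/-- a monad on a preadditive category with finite biproducts is a Hopf
monad if and only if
`T(1_A ⊕ 0) + T(ι₂) ∘ η_{T(B)} ∘ μ_B ∘ T(π₂) − T(ι₂) ∘ η_{T(B)} ∘ T(0) = 1_{T(A ⊕ T(B))}`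
for all `A, B`. -/
theorem isHopf_iff_of_neg (T : Monad C) :
    (∀ A B : C, IsIso (fusion T A B)) ↔
      (∀ A B : C,
        T.map (biprod.map (𝟙 A) (0 : T.obj B ⟶ T.obj B)) +
            T.map biprod.snd ≫ T.μ.app B ≫ T.η.app (T.obj B) ≫ T.map biprod.inr -
            T.map (0 : A ⊞ T.obj B ⟶ B) ≫ T.η.app (T.obj B) ≫ T.map biprod.inr =
          𝟙 (T.obj (A ⊞ T.obj B))) := by
  simp only [isIso_fusion_iff, fusion_fusionSection]

end HopfBiproductsNeg
end
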